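/- Rate function of the reinforced multinomial process characterizes the two-scale measure: fix γ > −1, H : X_2 × X_1 → ℝ, μ ∈ ℝ, and uniform base measure q on X_2 × X_1. The unique maximizer over probability distributions p on X_2 × X_1 of R[p] = −D_KL(p^{<1}‖q^{<1}) − (1+γ) Σ_{x_1} p^{<1}(x_1) D_KL(p^{<2}(·|x_1)‖q^{<2}(·|x_1)) + μ Σ_{x} p(x) H(x) is the two-scale measure with ζ₂ = μ/(1+γ): p^{<2}(x_2|x_1) = e^{ζ₂ H(x_2,x_1)}/Z_1(x_1), p^{<1}(x_1) ∝ Z_1(x_1)^{1+γ}. -/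

import Mathlib

open Finset Real

/-- Marginal on `X₁` of a distribution on `X₂ × X₁`. -/
noncomputable def marg1 {X₁ X₂ : Type*} [Fintype X₂] (p : X₂ × X₁ → ℝ) (x₁ : X₁) : ℝ :=
  ∑ x₂ : X₂, p (x₂, x₁)

/-- Conditional distribution on `X₂` given `x₁`. -/
noncomputable def cond2 {X₁ X₂ : Type*} [Fintype X₂] (p : X₂ × X₁ → ℝ)
    (x₂ : X₂) (x₁ : X₁) : ℝ :=
  p (x₂, x₁) / marg1 p x₁

/-- Kullback–Leibler divergence on a finite set (natural log, `0 log 0 = 0`). -/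
noncomputable def klDiv {X : Type*} [Fintype X] (p q : X → ℝ) : ℝ :=
  ∑ i, p i * Real.log (p i / q i)

/-- The rate functional of the reinforced multinomial process (plus energy term),
with uniform base measure:
`R[p] = −D(p^{<1}‖unif) − (1+γ) Σ_{x₁} p^{<1}(x₁) D(p^{<2}(·|x₁)‖unif) + μ Σ p H`. -/
noncomputable def Rfun {X₁ X₂ : Type*} [Fintype X₁] [Fintype X₂]
    (H : X₂ × X₁ → ℝ) (μ γ : ℝ) (p : X₂ × X₁ → ℝ) : ℝ :=
  - klDiv (marg1 p) (fun _ : X₁ => 1 / Fintype.card X₁) -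
    (1 + γ) * ∑ x₁, marg1 p x₁ *
      klDiv (fun x₂ => cond2 p x₂ x₁) (fun _ : X₂ => 1 / Fintype.card X₂) +
    μ * ∑ z, p z * H z

/-- Inner partition function `Z₁(x₁) = Σ_{x₂} e^{ζ₂ H(x₂,x₁)}` with `ζ₂ = μ/(1+γ)`. -/
noncomputable def Z1 {X₁ X₂ : Type*} [Fintype X₂] (H : X₂ × X₁ → ℝ) (ζ₂ : ℝ)
    (x₁ : X₁) : ℝ :=
  ∑ x₂, Real.exp (ζ₂ * H (x₂, x₁))

/-- The two-scale measure `p^{<2}(x₂|x₁) = e^{ζ₂H}/Z₁(x₁)`, `p^{<1}(x₁) ∝ Z₁(x₁)^{1+γ}`. -/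
noncomputable def twoScale {X₁ X₂ : Type*} [Fintype X₁] [Fintype X₂]
    (H : X₂ × X₁ → ℝ) (μ γ : ℝ) (z : X₂ × X₁) : ℝ :=
  (Z1 H (μ / (1 + γ)) z.2 ^ (1 + γ) / ∑ y₁, Z1 H (μ / (1 + γ)) y₁ ^ (1 + γ)) *
    (Real.exp ((μ / (1 + γ)) * H z) / Z1 H (μ / (1 + γ)) z.2)

theorem aux_klDiv_nonneg {X : Type*} [Fintype X] (p q : X → ℝ) (hp : ∀ i, 0 ≤ p i)
    (hq : ∀ i, 0 < q i) (h : ∑ i, p i = 1) (h' : ∑ i, q i = 1) :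
    0 ≤ klDiv p q ∧ (klDiv p q = 0 → p = q) := by
  have key : klDiv p q = ∑ i, q i * InformationTheory.klFun (p i / q i) := by
    have : ∀ i, q i * InformationTheory.klFun (p i / q i)
        = p i * Real.log (p i / q i) + (q i - p i) := by
      intro i
      have := (hq i).ne'
      unfold InformationTheory.klFun
      field_simp
      ring
    simp only [this, sum_add_distrib, sum_sub_distrib, h, h', klDiv]
    ring
  have nn : ∀ i, 0 ≤ q i * InformationTheory.klFun (p i / q i) := fun i =>
    mul_nonneg (hq i).le (InformationTheory.klFun_nonneg (div_nonneg (hp i) (hq i).le))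
  refine ⟨by rw [key]; exact sum_nonneg fun i _ => nn i, fun h0 => ?_⟩
  rw [key, sum_eq_zero_iff_of_nonneg (fun i _ => nn i)] at h0
  funext i
  have h1 := h0 i (mem_univ i)
  rcases mul_eq_zero.1 h1 with h2 | h2
  · exact absurd h2 (hq i).ne'
  · rw [InformationTheory.klFun_eq_zero_iff (div_nonneg (hp i) (hq i).le)] at h2
    exact (div_eq_one_iff_eq (hq i).ne').1 h2

theorem aux_klDiv_self {X : Type*} [Fintype X] (q : X → ℝ) (hq : ∀ i, 0 < q i) :
    klDiv q q = 0 := by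
  unfold klDiv
  refine sum_eq_zero fun i _ => ?_
  rw [div_self (hq i).ne']; simp

theorem aux_klDiv_change {X : Type*} [Fintype X] (p q r : X → ℝ)
    (hq : ∀ i, 0 < q i) (hr : ∀ i, 0 < r i) :
    klDiv p r = klDiv p q + ∑ i, p i * (Real.log (q i) - Real.log (r i)) := by
  unfold klDiv
  rw [← sum_add_distrib]
  refine sum_congr rfl fun i _ => ?_
  by_cases h : p i = 0
  · simp [h]
  · rw [Real.log_div h (hr i).ne', Real.log_div h (hq i).ne']; ring

theorem aux_marg_cond {X₁ X₂ : Type*} [Fintype X₂] (p : X₂ × X₁ → ℝ) (hp : ∀ z, 0 ≤ p z)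
    (x₂ : X₂) (x₁ : X₁) : marg1 p x₁ * cond2 p x₂ x₁ = p (x₂, x₁) := by
  unfold cond2
  by_cases h : marg1 p x₁ = 0
  · have := (sum_eq_zero_iff_of_nonneg (fun i _ => hp (i, x₁))).1 h x₂ (mem_univ _)
    rw [h, this]; simp
  · field_simp

theorem aux_sum {X₁ X₂ : Type*} [Fintype X₁] [Fintype X₂] (f : X₂ × X₁ → ℝ) :
    ∑ z, f z = ∑ x₁, ∑ x₂, f (x₂, x₁) := by
  rw [Fintype.sum_prod_type, sum_comm]

theorem aux_Z1_pos {X₁ X₂ : Type*} [Fintype X₂] [Nonempty X₂] (H : X₂ × X₁ → ℝ) (ζ : ℝ)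
    (x₁ : X₁) : 0 < Z1 H ζ x₁ :=
  sum_pos (fun _ _ => Real.exp_pos _) univ_nonempty

theorem aux_identity {X₁ X₂ : Type*} [Fintype X₁] [Fintype X₂]
    [Nonempty X₁] [Nonempty X₂]
    (H : X₂ × X₁ → ℝ) (a ζ W : ℝ) (hW : 0 < W)
    (p : X₂ × X₁ → ℝ) (hp : ∀ z, 0 ≤ p z) (h1 : ∑ z, p z = 1) :
    Rfun H (a * ζ) (a - 1) p =
      (Real.log W - Real.log (Fintype.card X₁) - a * Real.log (Fintype.card X₂)) -
      (klDiv (marg1 p) (fun x₁ => Z1 H ζ x₁ ^ a / W) +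
        a * ∑ x₁, marg1 p x₁ *
          klDiv (fun x₂ => cond2 p x₂ x₁) (fun x₂ => Real.exp (ζ * H (x₂, x₁)) / Z1 H ζ x₁)) := by
  have hZ := aux_Z1_pos H ζ
  have n1 : (0:ℝ) < Fintype.card X₁ := by exact_mod_cast Fintype.card_pos
  have n2 : (0:ℝ) < Fintype.card X₂ := by exact_mod_cast Fintype.card_pos
  have hm1 : ∑ x₁, marg1 p x₁ = 1 := by rw [← h1, aux_sum]; rfl
  have e1 := aux_klDiv_change (marg1 p) (fun x₁ => Z1 H ζ x₁ ^ a / W)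
    (fun _ : X₁ => 1 / (Fintype.card X₁ : ℝ))
    (fun i => div_pos (Real.rpow_pos_of_pos (hZ i) _) hW) (fun _ => by positivity)
  have e1' : ∑ i, marg1 p i * (Real.log (Z1 H ζ i ^ a / W) -
      Real.log (1 / (Fintype.card X₁ : ℝ))) =
      a * ∑ i, marg1 p i * Real.log (Z1 H ζ i) - Real.log W + Real.log (Fintype.card X₁) := by
    have : ∀ i, marg1 p i * (Real.log (Z1 H ζ i ^ a / W) -
      Real.log (1 / (Fintype.card X₁ : ℝ))) = a * (marg1 p i * Real.log (Z1 H ζ i))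
        + marg1 p i * (Real.log (Fintype.card X₁) - Real.log W) := by
      intro i
      rw [Real.log_div (Real.rpow_pos_of_pos (hZ i) _).ne' hW.ne', Real.log_rpow (hZ i),
        one_div, Real.log_inv]
      ring
    simp only [this, sum_add_distrib, ← mul_sum, ← sum_mul, hm1]
    ring
  have e2 : ∀ x₁, marg1 p x₁ * klDiv (fun x₂ => cond2 p x₂ x₁)
        (fun _ : X₂ => 1 / (Fintype.card X₂ : ℝ)) =
      marg1 p x₁ * klDiv (fun x₂ => cond2 p x₂ x₁)
          (fun x₂ => Real.exp (ζ * H (x₂, x₁)) / Z1 H ζ x₁) +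
        (ζ * ∑ x₂, p (x₂, x₁) * H (x₂, x₁) - marg1 p x₁ * Real.log (Z1 H ζ x₁)
          + marg1 p x₁ * Real.log (Fintype.card X₂)) := by
    intro x₁
    rw [aux_klDiv_change (fun x₂ => cond2 p x₂ x₁)
      (fun x₂ => Real.exp (ζ * H (x₂, x₁)) / Z1 H ζ x₁) _
      (fun i => div_pos (Real.exp_pos _) (hZ x₁)) (fun _ => by positivity), mul_add]
    congr 1
    rw [mul_sum]
    have : ∀ x₂, marg1 p x₁ * (cond2 p x₂ x₁ * (Real.log (Real.exp (ζ * H (x₂, x₁)) / Z1 H ζ x₁)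
        - Real.log (1 / (Fintype.card X₂ : ℝ)))) = ζ * (p (x₂, x₁) * H (x₂, x₁)) -
          p (x₂, x₁) * Real.log (Z1 H ζ x₁) + p (x₂, x₁) * Real.log (Fintype.card X₂) := by
      intro x₂
      rw [← mul_assoc, aux_marg_cond p hp, Real.log_div (Real.exp_pos _).ne' (hZ x₁).ne',
        Real.log_exp, one_div, Real.log_inv]
      ring
    simp only [this, sum_add_distrib, sum_sub_distrib, ← mul_sum, ← sum_mul]
    rfl
  unfold Rfun
  rw [e1, e1']
  simp only [e2, sum_add_distrib, sum_sub_distrib, ← mul_sum, ← sum_mul, hm1]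
  rw [aux_sum (fun z => p z * H z)]
  ring

/-- The rate functional of the reinforced multinomial process is uniquely maximized
by the two-scale measure with `ζ₂ = μ/(1+γ)`. -/
theorem reinforced_rate_function_maximizer {X₁ X₂ : Type*} [Fintype X₁] [Fintype X₂]
    [Nonempty X₁] [Nonempty X₂]
    (H : X₂ × X₁ → ℝ) (μ γ : ℝ) (hγ : -1 < γ) :
    (∀ p : X₂ × X₁ → ℝ, (∀ z, 0 ≤ p z) → ∑ z, p z = 1 →
        Rfun H μ γ p ≤ Rfun H μ γ (twoScale H μ γ)) ∧
    (∀ p : X₂ × X₁ → ℝ, (∀ z, 0 ≤ p z) → ∑ z, p z = 1 →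
        Rfun H μ γ p = Rfun H μ γ (twoScale H μ γ) → p = twoScale H μ γ) := by
  obtain ⟨a, rfl⟩ : ∃ a, γ = a - 1 := ⟨γ + 1, by ring⟩
  have ha : 0 < a := by linarith
  obtain ⟨ζ, rfl⟩ : ∃ ζ, μ = a * ζ := ⟨μ / a, by field_simp⟩
  have hZ := aux_Z1_pos H ζ
  obtain ⟨W, hWd⟩ : ∃ W, W = ∑ y₁, Z1 H ζ y₁ ^ a := ⟨_, rfl⟩
  have hW : 0 < W := by
    rw [hWd]; exact sum_pos (fun i _ => Real.rpow_pos_of_pos (hZ i) _) univ_nonempty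
  have hT : ∀ x₂ x₁, twoScale H (a * ζ) (a - 1) (x₂, x₁) =
      (Z1 H ζ x₁ ^ a / W) * (Real.exp (ζ * H (x₂, x₁)) / Z1 H ζ x₁) := by
    intro x₂ x₁
    have e1 : 1 + (a - 1) = a := by ring
    have e2 : a * ζ / a = ζ := by field_simp
    simp only [twoScale, e1, e2, hWd]
  have hM : ∀ x₁, 0 < Z1 H ζ x₁ ^ a / W := fun i => div_pos (Real.rpow_pos_of_pos (hZ i) _) hW
  have hG : ∀ x₁ x₂, 0 < Real.exp (ζ * H (x₂, x₁)) / Z1 H ζ x₁ :=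
    fun i j => div_pos (Real.exp_pos _) (hZ i)
  have hMs : ∑ x₁, Z1 H ζ x₁ ^ a / W = 1 := by
    rw [← sum_div, ← hWd, div_self hW.ne']
  have hGs : ∀ x₁, ∑ x₂, Real.exp (ζ * H (x₂, x₁)) / Z1 H ζ x₁ = 1 := by
    intro x₁
    rw [← sum_div]; exact div_self (hZ x₁).ne'
  generalize hTd : twoScale H (a * ζ) (a - 1) = T at *
  have hTm : marg1 T = fun x₁ => Z1 H ζ x₁ ^ a / W := by
    funext x₁
    simp only [marg1, hT, ← mul_sum, hGs, mul_one]
  have hTc : ∀ x₁, (fun x₂ => cond2 T x₂ x₁) =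
      fun x₂ => Real.exp (ζ * H (x₂, x₁)) / Z1 H ζ x₁ := by
    intro x₁
    funext x₂
    simp only [cond2, hTm, hT]
    exact mul_div_cancel_left₀ _ (hM x₁).ne'
  have hT0 : ∀ z, 0 ≤ T z := by
    rintro ⟨x₂, x₁⟩
    rw [hT]; exact (mul_pos (hM _) (hG _ _)).le
  have hT1 : ∑ z, T z = 1 := by
    rw [aux_sum]; simp only [hT, ← mul_sum, hGs, mul_one, hMs]
  have hTR := aux_identity H a ζ W hW T hT0 hT1
  simp only [hTc, hTm, aux_klDiv_self _ hM, aux_klDiv_self _ (hG _), mul_zero, sum_const_zero,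
    add_zero, sub_zero] at hTR
  have main : ∀ p : X₂ × X₁ → ℝ, (∀ z, 0 ≤ p z) → ∑ z, p z = 1 →
      Rfun H (a * ζ) (a - 1) p ≤ Rfun H (a * ζ) (a - 1) T ∧
      (Rfun H (a * ζ) (a - 1) p = Rfun H (a * ζ) (a - 1) T → p = T) := by
    intro p hp h1
    have hR := aux_identity H a ζ W hW p hp h1
    have hm : ∀ x₁, 0 ≤ marg1 p x₁ := fun x₁ => sum_nonneg fun i _ => hp _
    have hm1 : ∑ x₁, marg1 p x₁ = 1 := by rw [← h1, aux_sum]; rfl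
    obtain ⟨k1, k2⟩ := aux_klDiv_nonneg (marg1 p) _ hm hM hm1 hMs
    have kc : ∀ x₁, marg1 p x₁ ≠ 0 → _ := fun x₁ hx =>
      aux_klDiv_nonneg (fun x₂ => cond2 p x₂ x₁) _
        (fun i => div_nonneg (hp _) (hm x₁)) (hG x₁)
        (by simp only [cond2, ← sum_div]; exact div_self hx) (hGs x₁)
    have nn : ∀ x₁, 0 ≤ marg1 p x₁ * klDiv (fun x₂ => cond2 p x₂ x₁)
        (fun x₂ => Real.exp (ζ * H (x₂, x₁)) / Z1 H ζ x₁) := by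
      intro x₁
      by_cases hx : marg1 p x₁ = 0
      · simp [hx]
      · exact mul_nonneg (hm x₁) (kc x₁ hx).1
    have S := sum_nonneg fun x₁ (_ : x₁ ∈ univ) => nn x₁
    have aS := mul_nonneg ha.le S
    refine ⟨by rw [hR, hTR]; linarith, fun he => ?_⟩
    rw [hR, hTR] at he
    have z1 := k2 (by linarith)
    have z2 := (mul_eq_zero.1 (le_antisymm (by linarith) aS)).resolve_left ha.ne'
    rw [sum_eq_zero_iff_of_nonneg (fun i _ => nn i)] at z2
    funext ⟨x₂, x₁⟩
    have hx : marg1 p x₁ ≠ 0 := by rw [z1]; exact (hM x₁).ne'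
    have c := congrFun ((kc x₁ hx).2 ((mul_eq_zero.1 (z2 x₁ (mem_univ _))).resolve_left hx)) x₂
    rw [← aux_marg_cond p hp, c, hT, z1]
  exact ⟨fun p hp h1 => (main p hp h1).1, fun p hp h1 => (main p hp h1).2⟩
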